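/- Let Γ = ⟨α, β⟩ with α, β coprime, both odd, and 3 ≤ α < β. For every ℓ with 0 ≤ ℓ ≤ (α−1)/2, the number of sets Δ ⊆ ℕ with 0 ∈ Δ and Δ + Γ ⊆ Δ that are selfdual and whose minimal system of generators has exactly 2ℓ + 1 elements equals C((α−1)/2, ℓ) · C((β−1)/2, ℓ). -/

import Mathlib

/-- The numerical semigroup `⟨α, β⟩ = {pα + qβ : p, q ∈ ℕ}`, viewed inside `ℤ`. -/
def Gamma (α β : ℕ) : Set ℤ := {x : ℤ | ∃ p q : ℕ, x = (p : ℤ) * α + (q : ℤ) * β}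

/-- The dual `Δ* = {c ∈ ℤ : c + Δ ⊆ ⟨α,β⟩}` of an `⟨α,β⟩`-semimodule. -/
def dualSet (α β : ℕ) (Δ : Set ℤ) : Set ℤ := {c : ℤ | ∀ x ∈ Δ, c + x ∈ Gamma α β}

/-- A normalized `⟨α,β⟩`-semimodule: a subset of `ℕ` containing `0`
with `Δ + Γ ⊆ Δ`. -/
def IsNormalizedSemimodule (α β : ℕ) (Δ : Set ℤ) : Prop :=
  (0 : ℤ) ∈ Δ ∧ (∀ x ∈ Δ, 0 ≤ x) ∧ ∀ x ∈ Δ, ∀ γ ∈ Gamma α β, x + γ ∈ Δ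

/-- `Δ` is selfdual if `Δ*` is a shift of `Δ`. -/
def IsSelfdual (α β : ℕ) (Δ : Set ℤ) : Prop :=
  ∃ c : ℤ, dualSet α β Δ = (fun x => c + x) '' Δ

/-- `E` is the minimal system of generators of `Δ`: it generates `Δ`
(`⋃_{x∈E}(x+Γ) = Δ`) and no proper subset of it generates `Δ`. -/
def IsMinGenSet (α β : ℕ) (Δ : Set ℤ) (E : Finset ℤ) : Prop :=
  (↑E ⊆ Δ) ∧ (⋃ x ∈ (E : Set ℤ), (fun γ => x + γ) '' Gamma α β) = Δ ∧
    ∀ F : Finset ℤ, F ⊂ E → (⋃ x ∈ (F : Set ℤ), (fun γ => x + γ) '' Gamma α β) ≠ Δ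


/-! ### Counting binary words by number of changes -/

def WT (x : Bool) (m A c : ℕ) : Set (ℕ → Bool) :=
  {G | G 0 = x ∧ (∀ i, m ≤ i → G i = true) ∧
    (∑ i ∈ Finset.range m, if G i = true then 1 else 0) = A ∧
    (∑ i ∈ Finset.range m, if G i ≠ G (i + 1) then 1 else 0) = c}

def consF (x : Bool) (G : ℕ → Bool) : ℕ → Bool
  | 0 => x
  | i + 1 => G i

lemma consF_inj (x : Bool) : Function.Injective (consF x) := by
  intro G H h
  funext i
  exact congrFun h (i + 1)

lemma consF_eta (G : ℕ → Bool) : consF (G 0) (fun i => G (i + 1)) = G := by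
  funext i
  cases i <;> rfl

lemma mem_WT_succ (x : Bool) (m A c : ℕ) (G : ℕ → Bool) :
    G ∈ WT x (m + 1) A c ↔ G 0 = x ∧ ∃ A' c', (fun i => G (i + 1)) ∈ WT (G 1) m A' c' ∧
      A = A' + (if x = true then 1 else 0) ∧ c = c' + (if x ≠ G 1 then 1 else 0) := by
  constructor
  · rintro ⟨h0, h1, h2, h3⟩
    rw [Finset.sum_range_succ'] at h2 h3
    refine ⟨h0, _, _, ⟨rfl, fun i hi => h1 (i + 1) (by omega), rfl, rfl⟩, ?_, ?_⟩
    · rw [← h2, h0]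
    · rw [← h3, ← h0]
  · rintro ⟨h0, A', c', ⟨-, h1, h2, h3⟩, hA, hc⟩
    refine ⟨h0, ?_, ?_, ?_⟩
    · intro i hi
      obtain ⟨k, rfl⟩ : ∃ k, i = k + 1 := ⟨i - 1, by omega⟩
      exact h1 k (by omega)
    · rw [Finset.sum_range_succ', hA, ← h2, h0]
    · rw [Finset.sum_range_succ', hc, ← h3, ← h0]

lemma WT_finite (m : ℕ) : ∀ x A c, (WT x m A c).Finite := by
  have key : {G : ℕ → Bool | ∀ i, m ≤ i → G i = true}.Finite := by
    apply Set.Finite.of_finite_image (f := fun G (i : Fin m) => G i) (Set.toFinite _)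
    intro G hG H hH h
    funext i
    by_cases hi : i < m
    · exact congrFun h ⟨i, hi⟩
    · rw [hG i (by omega), hH i (by omega)]
  intro x A c
  exact key.subset (fun G hG => hG.2.1)

lemma WT_false_succ_succ (m A c : ℕ) :
    WT false (m + 1) A (c + 1) = consF false '' (WT false m A (c + 1) ∪ WT true m A c) := by
  ext G
  rw [mem_WT_succ]
  constructor
  · rintro ⟨h0, A', c', h, hA, hc⟩
    refine ⟨fun i => G (i + 1), ?_, by rw [← h0]; exact consF_eta G⟩
    cases h1 : G 1 <;> simp [h1] at h hA hc
    · left; subst hA; rw [hc]; exact h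
    · right; subst hA; rw [hc]; exact h
  · rintro ⟨H, hH | hH, rfl⟩
    · refine ⟨rfl, A, c + 1, ?_, by simp, ?_⟩
      · have : H 0 = false := hH.1
        simp only [consF]; rw [this]; exact hH
      · have : H 0 = false := hH.1
        simp [consF, this]
    · refine ⟨rfl, A, c, ?_, by simp, ?_⟩
      · have : H 0 = true := hH.1
        simp only [consF]; rw [this]; exact hH
      · have : H 0 = true := hH.1
        simp [consF, this]

lemma WT_true_succ_succ (m A c : ℕ) :
    WT true (m + 1) (A + 1) (c + 1) =
      consF true '' (WT true m A (c + 1) ∪ WT false m A c) := by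
  ext G
  rw [mem_WT_succ]
  constructor
  · rintro ⟨h0, A', c', h, hA, hc⟩
    refine ⟨fun i => G (i + 1), ?_, by rw [← h0]; exact consF_eta G⟩
    cases h1 : G 1 <;> simp [h1] at h hA hc
    · right; subst hA; rw [hc]; exact h
    · left; subst hA; rw [hc]; exact h
  · rintro ⟨H, hH | hH, rfl⟩
    · refine ⟨rfl, A, c + 1, ?_, by simp, ?_⟩
      · have : H 0 = true := hH.1
        simp only [consF]; rw [this]; exact hH
      · have : H 0 = true := hH.1
        simp [consF, this]
    · refine ⟨rfl, A, c, ?_, by simp, ?_⟩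
      · have : H 0 = false := hH.1
        simp only [consF]; rw [this]; exact hH
      · have : H 0 = false := hH.1
        simp [consF, this]

lemma WT_true_succ_zero (m A : ℕ) :
    WT true (m + 1) (A + 1) 0 = consF true '' (WT true m A 0) := by
  ext G
  rw [mem_WT_succ]
  constructor
  · rintro ⟨h0, A', c', h, hA, hc⟩
    refine ⟨fun i => G (i + 1), ?_, by rw [← h0]; exact consF_eta G⟩
    cases h1 : G 1 <;> simp [h1] at h hA hc
    · subst hA; rw [← hc] at h; exact h
  · rintro ⟨H, hH, rfl⟩
    · refine ⟨rfl, A, 0, ?_, by simp, ?_⟩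
      · have : H 0 = true := hH.1
        simp only [consF]; rw [this]; exact hH
      · have : H 0 = true := hH.1
        simp [consF, this]

lemma WT_true_Azero (m c : ℕ) : WT true (m + 1) 0 c = ∅ := by
  ext G
  rw [mem_WT_succ]
  simp

lemma WT_false_full (m c : ℕ) : WT false m m c = ∅ := by
  ext G
  simp only [Set.mem_empty_iff_false, iff_false]
  rintro ⟨h0, h1, h2, -⟩
  cases m with
  | zero => simpa [h0] using h1 0 le_rfl
  | succ m =>
    rw [Finset.sum_range_succ', h0] at h2
    have : (∑ i ∈ Finset.range m, if G (i + 1) = true then 1 else 0) ≤ ∑ i ∈ Finset.range m, 1 :=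
      Finset.sum_le_sum (fun i _ => by split_ifs <;> simp)
    simp only [Finset.sum_const, Finset.card_range, smul_eq_mul, mul_one] at this
    simp at h2
    simp at this
    omega

def Qf (A : ℕ) : ℕ → ℕ → ℕ
  | 0, 0 => 1
  | 0, _ + 1 => 0
  | _ + 1, 0 => 0
  | U + 1, l + 1 => Nat.choose A (l + 1) * Nat.choose U l

lemma WT_disj (m A A' c c' : ℕ) (x : Bool) : Disjoint (WT x m A c) (WT (!x) m A' c') := by
  rw [Set.disjoint_left]
  intro G h h'
  have h1 := h.1
  have h2 := h'.1
  rw [h1] at h2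
  cases x <;> simp at h2

lemma WT_card (m : ℕ) :
    (∀ A U l, A + (U + 1) = m → (WT false m A (2 * l + 1)).ncard = Nat.choose A l * Nat.choose U l) ∧
    (∀ A U l, A + U = m → (WT true m A (2 * l)).ncard = Qf A U l) := by
  induction m with
  | zero =>
    refine ⟨fun A U l h => by omega, ?_⟩
    intro A U l h
    obtain ⟨rfl, rfl⟩ : A = 0 ∧ U = 0 := by omega
    cases l with
    | zero =>
      have : WT true 0 0 (2 * 0) = {fun _ => true} := by
        ext G
        simp only [WT, Set.mem_ofPred_eq, Set.mem_singleton_iff]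
        constructor
        · rintro ⟨_, h, _⟩
          funext i
          exact h i (Nat.zero_le _)
        · rintro rfl
          simp
      rw [this]
      simp [Qf]
    | succ l =>
      have : WT true 0 0 (2 * (l + 1)) = ∅ := by
        ext G
        simp [WT]
      rw [this]
      simp [Qf]
  | succ m ih =>
    obtain ⟨ihP, ihQ⟩ := ih
    constructor
    · intro A U l h
      rw [WT_false_succ_succ, Set.ncard_image_of_injective _ (consF_inj _),
        Set.ncard_union_eq (by exact WT_disj _ _ _ _ _ false) (WT_finite _ _ _ _) (WT_finite _ _ _ _),
        ihQ A U l (by omega)]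
      cases U with
      | zero =>
        obtain rfl : A = m := by omega
        rw [WT_false_full]
        cases l <;> simp [Qf]
      | succ V =>
        rw [ihP A V l (by omega)]
        cases l with
        | zero => simp [Qf]
        | succ k =>
          simp only [Qf]
          rw [Nat.choose_succ_succ V k]
          ring
    · intro A U l h
      cases A with
      | zero =>
        rw [WT_true_Azero]
        obtain rfl : U = m + 1 := by omega
        cases l <;> simp [Qf]
      | succ A =>
        cases l with
        | zero =>
          rw [Nat.mul_zero, WT_true_succ_zero, Set.ncard_image_of_injective _ (consF_inj _)]
          have := ihQ A U 0 (by omega)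
          rw [Nat.mul_zero] at this
          rw [this]
          cases U <;> simp [Qf]
        | succ k =>
          rw [show 2 * (k + 1) = (2 * k + 1) + 1 by ring, WT_true_succ_succ,
            Set.ncard_image_of_injective _ (consF_inj _),
            Set.ncard_union_eq (by exact WT_disj _ _ _ _ _ true) (WT_finite _ _ _ _) (WT_finite _ _ _ _),
            show (2 * k + 1) + 1 = 2 * (k + 1) by ring, ihQ A U (k + 1) (by omega)]
          cases U with
          | zero =>
            obtain rfl : A = m := by omega
            rw [WT_false_full]
            simp [Qf]
          | succ V =>
            rw [ihP A V k (by omega)]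
            simp only [Qf]
            rw [Nat.choose_succ_succ A k]
            ring

/-! ### Semimodules and symmetry -/

lemma gamma_rep (α β : ℕ) (hα : 0 < α) (hcop : Nat.Coprime α β) (x : ℤ) :
    ∃ p q : ℤ, x = p * α + q * β ∧ 0 ≤ q ∧ q < α := by
  have hc : IsCoprime (α : ℤ) (β : ℤ) := Nat.isCoprime_iff_coprime.mpr hcop
  obtain ⟨u, v, huv⟩ := hc
  refine ⟨x * u + β * ((x * v) / α), (x * v) % α, ?_, Int.emod_nonneg _ (by positivity),
    Int.emod_lt_of_pos _ (by positivity)⟩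
  have h := Int.emod_add_mul_ediv (x * v) α
  linear_combination (-x) * huv + (-(β : ℤ)) * h

lemma gamma_mem_iff (α β : ℕ) (hα : 0 < α) (hcop : Nat.Coprime α β) (p q : ℤ)
    (hq : 0 ≤ q) (hq' : q < α) : p * α + q * β ∈ Gamma α β ↔ 0 ≤ p := by
  have hc : IsCoprime (α : ℤ) (β : ℤ) := Nat.isCoprime_iff_coprime.mpr hcop
  constructor
  · rintro ⟨p', q', h⟩
    have hd : (α : ℤ) ∣ (q' - q) * β := ⟨p - p', by linear_combination -h⟩
    obtain ⟨t, ht⟩ := hc.dvd_of_dvd_mul_right hd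
    have hα' : (0 : ℤ) < α := by exact_mod_cast hα
    have ht0 : 0 ≤ t := by
      by_contra hneg
      have : t ≤ -1 := by omega
      have : (α : ℤ) * t ≤ α * (-1) := by gcongr
      have : (0 : ℤ) ≤ q' := by positivity
      linarith
    have : (p - p' - t * β) * α = 0 := by linear_combination h + β * ht
    have h2 : p - p' - t * β = 0 := by
      rcases mul_eq_zero.mp this with h | h
      · exact h
      · omega
    have : 0 ≤ t * β := by positivity
    have : (0 : ℤ) ≤ p' := by positivity
    linarith
  · intro hp
    exact ⟨p.toNat, q.toNat, by rw [Int.toNat_of_nonneg hp, Int.toNat_of_nonneg hq]⟩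

lemma gamma_symm (α β : ℕ) (hα : 0 < α) (hcop : Nat.Coprime α β) (x : ℤ) :
    x ∈ Gamma α β ↔ (α * β - α - β : ℤ) - x ∉ Gamma α β := by
  obtain ⟨p, q, rfl, h0, h1⟩ := gamma_rep α β hα hcop x
  rw [gamma_mem_iff α β hα hcop p q h0 h1,
    show (α * β - α - β : ℤ) - (p * α + q * β) = (-1 - p) * α + (α - 1 - q) * β by ring,
    gamma_mem_iff α β hα hcop _ _ (by omega) (by omega)]
  omega

def Closed (α β : ℕ) (Δ : Set ℤ) : Prop := ∀ x ∈ Δ, x + α ∈ Δ ∧ x + β ∈ Δ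

lemma closed_iff (α β : ℕ) (Δ : Set ℤ) :
    (∀ x ∈ Δ, ∀ γ ∈ Gamma α β, x + γ ∈ Δ) ↔ Closed α β Δ := by
  constructor
  · intro h x hx
    exact ⟨h x hx _ ⟨1, 0, by simp⟩, h x hx _ ⟨0, 1, by simp⟩⟩
  · rintro h x hx _ ⟨p, q, rfl⟩
    have h1 : ∀ p : ℕ, x + (p : ℤ) * α ∈ Δ := by
      intro p
      induction p with
      | zero => simpa using hx
      | succ p ih =>
        have := (h _ ih).1
        convert this using 1
        push_cast; ring
    have h2 : ∀ q : ℕ, x + ((p : ℤ) * α + (q : ℤ) * β) ∈ Δ := by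
      intro q
      induction q with
      | zero => simpa using h1 p
      | succ p ih =>
        have := (h _ ih).2
        convert this using 1
        push_cast; ring
    exact h2 q

def Symm (K : ℤ) (Δ : Set ℤ) : Prop := ∀ x, x ∈ Δ ↔ K - x ∉ Δ

lemma selfdual_iff (α β : ℕ) (hα : 0 < α) (hcop : Nat.Coprime α β) (Δ : Set ℤ)
    (hcl : Closed α β Δ) : IsSelfdual α β Δ ↔ ∃ K, Symm K Δ := by
  have hF : (α * β - α - β : ℤ) ∉ Gamma α β := by
    have := (gamma_symm α β hα hcop 0).1 ⟨0, 0, by simp⟩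
    simpa using this
  have hd : ∀ c, c ∈ dualSet α β Δ ↔ (α * β - α - β : ℤ) - c ∉ Δ := by
    intro c
    constructor
    · intro h hm
      have := h _ hm
      rw [show c + ((α * β - α - β : ℤ) - c) = α * β - α - β by ring] at this
      exact hF this
    · intro h x hx
      rw [gamma_symm α β hα hcop]
      intro hg
      apply h
      have := (closed_iff α β Δ).2 hcl x hx _ hg
      convert this using 1
      ring
  constructor
  · rintro ⟨c, hc⟩
    refine ⟨(α * β - α - β : ℤ) - c, fun x => ?_⟩
    have : c + x ∈ dualSet α β Δ ↔ x ∈ Δ := by rw [hc]; simp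
    rw [← this, hd]
    rw [show (α * β - α - β : ℤ) - (c + x) = (α * β - α - β : ℤ) - c - x by ring]
  · rintro ⟨K, hK⟩
    refine ⟨(α * β - α - β : ℤ) - K, ?_⟩
    ext y
    rw [hd]
    constructor
    · intro h
      refine ⟨y - ((α * β - α - β : ℤ) - K), (hK _).2 ?_, by ring⟩
      convert h using 2
      ring
    · rintro ⟨x, hx, rfl⟩
      have := (hK x).1 hx
      convert this using 2
      ring

def gens (α β : ℕ) (Δ : Set ℤ) : Set ℤ := {x | x ∈ Δ ∧ x - α ∉ Δ ∧ x - β ∉ Δ}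

lemma gens_gen (α β : ℕ) (hα : 0 < α) (hβ : 0 < β) (Δ : Set ℤ) (hcl : Closed α β Δ)
    (hb : ∀ x ∈ Δ, 0 ≤ x) :
    (⋃ x ∈ gens α β Δ, (fun γ => x + γ) '' Gamma α β) = Δ := by
  apply Set.Subset.antisymm
  · intro y hy
    simp only [Set.mem_iUnion] at hy
    obtain ⟨x, hx, γ, hγ, rfl⟩ := hy
    exact (closed_iff α β Δ).2 hcl x hx.1 γ hγ
  · have : ∀ N : ℕ, ∀ y ∈ Δ, y < N → y ∈ (⋃ x ∈ gens α β Δ, (fun γ => x + γ) '' Gamma α β) := by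
      intro N
      induction N with
      | zero =>
        intro y hy hN
        have := hb y hy
        simp at hN
        omega
      | succ N ih =>
        intro y hy hN
        by_cases h1 : y - α ∈ Δ
        · have := ih _ h1 (by push_cast at hN; omega)
          simp only [Set.mem_iUnion] at this ⊢
          obtain ⟨x, hx, γ, ⟨p, q, rfl⟩, h⟩ := this
          refine ⟨x, hx, _, ⟨p + 1, q, rfl⟩, ?_⟩
          push_cast
          simp only at h
          linear_combination h
        by_cases h2 : y - β ∈ Δ
        · have := ih _ h2 (by push_cast at hN; omega)
          simp only [Set.mem_iUnion] at this ⊢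
          obtain ⟨x, hx, γ, ⟨p, q, rfl⟩, h⟩ := this
          refine ⟨x, hx, _, ⟨p, q + 1, rfl⟩, ?_⟩
          push_cast
          simp only at h
          linear_combination h
        simp only [Set.mem_iUnion]
        exact ⟨y, ⟨hy, h1, h2⟩, 0, ⟨0, 0, by simp⟩, by simp⟩
    intro y hy
    exact this (y.toNat + 1) y hy (by push_cast; omega)

lemma gens_sub (α β : ℕ) (Δ : Set ℤ) (hcl : Closed α β Δ) (E : Set ℤ) (hE : E ⊆ Δ)
    (h : (⋃ x ∈ E, (fun γ => x + γ) '' Gamma α β) = Δ) : gens α β Δ ⊆ E := by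
  rintro y ⟨hy, h1, h2⟩
  have hy' := hy
  rw [← h] at hy'
  simp only [Set.mem_iUnion] at hy'
  obtain ⟨x, hx, γ, ⟨p, q, rfl⟩, rfl⟩ := hy'
  have hc := (closed_iff α β Δ).2 hcl x (hE hx)
  rcases p with _ | p
  · rcases q with _ | q
    · simpa using hx
    · exfalso
      apply h2
      have := hc _ ⟨0, q, rfl⟩
      convert this using 1
      push_cast; ring
  · exfalso
    apply h1
    have := hc _ ⟨p, q, rfl⟩
    convert this using 1
    push_cast; ring

lemma mingen_iff (α β : ℕ) (hα : 0 < α) (hβ : 0 < β) (Δ : Set ℤ) (hcl : Closed α β Δ)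
    (hb : ∀ x ∈ Δ, 0 ≤ x) (k : ℕ) :
    (∃ E : Finset ℤ, IsMinGenSet α β Δ E ∧ E.card = k + 1) ↔ (gens α β Δ).ncard = k + 1 := by
  constructor
  · rintro ⟨E, ⟨hE, hg, hm⟩, hk⟩
    have hsub := gens_sub α β Δ hcl E hE hg
    have hfin : (gens α β Δ).Finite := E.finite_toSet.subset hsub
    have : hfin.toFinset = E := by
      by_contra hne
      refine hm hfin.toFinset ⟨?_, ?_⟩ ?_
      · intro x hx
        exact hsub (hfin.mem_toFinset.1 hx)
      · intro h
        apply hne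
        apply Finset.Subset.antisymm _ h
        intro x hx
        exact hsub (hfin.mem_toFinset.1 hx)
      · rw [hfin.coe_toFinset]
        exact gens_gen α β hα hβ Δ hcl hb
    rw [← hk, ← this, Set.ncard_eq_toFinset_card _ hfin]
  · intro hk
    have hfin : (gens α β Δ).Finite := Set.finite_of_ncard_ne_zero (by omega)
    refine ⟨hfin.toFinset, ⟨?_, ?_, ?_⟩, ?_⟩
    · rw [hfin.coe_toFinset]
      exact fun x hx => hx.1
    · rw [hfin.coe_toFinset]
      exact gens_gen α β hα hβ Δ hcl hb
    · intro F hF hgF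
      have hFΔ : (F : Set ℤ) ⊆ Δ := fun x hx => (hfin.mem_toFinset.1 (hF.1 hx)).1
      have := gens_sub α β Δ hcl F hFΔ hgF
      apply hF.2
      intro x hx
      exact this (hfin.mem_toFinset.1 hx)
    · rw [← hk, Set.ncard_eq_toFinset_card _ hfin]

def sh (s : ℤ) (Δ : Set ℤ) : Set ℤ := {x | x + s ∈ Δ}

lemma sh_closed (α β : ℕ) (s : ℤ) (Δ : Set ℤ) (h : Closed α β Δ) : Closed α β (sh s Δ) := by
  intro x hx
  have := h _ hx
  simp only [sh, Set.mem_ofPred_eq]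
  rw [add_right_comm x, add_right_comm x (β : ℤ)]
  exact this

lemma sh_symm (K s : ℤ) (Δ : Set ℤ) (h : Symm K Δ) : Symm (K - 2 * s) (sh s Δ) := by
  intro x
  have := h (x + s)
  simp only [sh, Set.mem_ofPred_eq]
  rw [this, show K - 2 * s - x + s = K - (x + s) by ring]

lemma sh_gens (α β : ℕ) (s : ℤ) (Δ : Set ℤ) :
    (gens α β (sh s Δ)).ncard = (gens α β Δ).ncard := by
  have : gens α β Δ = (fun x => x + s) '' gens α β (sh s Δ) := by
    ext x
    simp only [gens, sh, Set.mem_ofPred_eq, Set.mem_image]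
    constructor
    · rintro ⟨h1, h2, h3⟩
      refine ⟨x - s, ⟨?_, ?_, ?_⟩, by ring⟩
      · simpa using h1
      · rwa [show x - s - α + s = x - α by ring]
      · rwa [show x - s - β + s = x - β by ring]
    · rintro ⟨y, ⟨h1, h2, h3⟩, rfl⟩
      refine ⟨h1, ?_, ?_⟩
      · rwa [show y + s - α = y - α + s by ring]
      · rwa [show y + s - β = y - β + s by ring]
  rw [this, Set.ncard_image_of_injective _ (add_left_injective s)]

lemma sh_sh (s t : ℤ) (Δ : Set ℤ) : sh s (sh t Δ) = sh (s + t) Δ := by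
  ext x
  simp [sh, add_assoc]

lemma sh_zero (Δ : Set ℤ) : sh 0 Δ = Δ := by
  ext x
  simp [sh]

lemma symm_bdd (α β : ℕ) (hα : 0 < α) (hcop : Nat.Coprime α β) (K : ℤ) (Δ : Set ℤ)
    (hcl : Closed α β Δ) (hs : Symm K Δ) :
    ∃ B : ℤ, (∀ x ∈ Δ, B ≤ x) ∧ ∀ x, K - B < x → x ∈ Δ := by
  have hne : ∃ x0, x0 ∈ Δ := by
    by_cases h : (0 : ℤ) ∈ Δ
    · exact ⟨0, h⟩
    · refine ⟨K, (hs K).2 ?_⟩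
      simpa using h
  obtain ⟨x0, hx0⟩ := hne
  have hlarge : ∀ x, x0 + (α * β - α - β : ℤ) < x → x ∈ Δ := by
    intro x hx
    have hg : x - x0 ∈ Gamma α β := by
      rw [gamma_symm α β hα hcop]
      rintro ⟨p, q, h⟩
      have : (0 : ℤ) ≤ p * α + q * β := by positivity
      omega
    have := (closed_iff α β Δ).2 hcl x0 hx0 _ hg
    simpa using this
  refine ⟨K - (x0 + (α * β - α - β : ℤ)), ?_, ?_⟩
  · intro x hx
    by_contra hlt
    exact (hs x).1 hx (hlarge _ (by omega))
  · intro x hx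
    exact hlarge x (by omega)

def YS (α β : ℕ) (k : ℕ) : Set (Set ℤ) :=
  {Δ | Closed α β Δ ∧ Symm (-β) Δ ∧ (gens α β Δ).ncard = k}

lemma symm_odd (K : ℤ) (Δ : Set ℤ) (h : Symm K Δ) : ¬ ∃ t, K = 2 * t := by
  rintro ⟨t, rfl⟩
  have := h t
  rw [show 2 * t - t = t by ring] at this
  tauto

lemma step1 (α β : ℕ) (hα : 0 < α) (hβ : 0 < β) (hcop : Nat.Coprime α β) (hβodd : Odd β) (k : ℕ) :
    {Δ : Set ℤ | IsNormalizedSemimodule α β Δ ∧ IsSelfdual α β Δ ∧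
        ∃ E : Finset ℤ, IsMinGenSet α β Δ E ∧ E.card = k + 1}.ncard = (YS α β (k + 1)).ncard := by
  have hmin : ∀ Δ ∈ YS α β (k + 1), ∃ μ, μ ∈ Δ ∧ ∀ x ∈ Δ, μ ≤ x := by
    rintro Δ ⟨h1, h2, h3⟩
    obtain ⟨B, hB1, hB2⟩ := symm_bdd α β hα hcop _ Δ h1 h2
    obtain ⟨μ, hμ, hl⟩ := Int.exists_least_of_bdd (P := fun x => x ∈ Δ) ⟨B, hB1⟩
      ⟨_, hB2 _ (lt_add_one _)⟩
    exact ⟨μ, hμ, hl⟩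
  choose! μ hμ1 hμ2 using hmin
  have himg : {Δ : Set ℤ | IsNormalizedSemimodule α β Δ ∧ IsSelfdual α β Δ ∧
        ∃ E : Finset ℤ, IsMinGenSet α β Δ E ∧ E.card = k + 1} =
        (fun Δ => sh (μ Δ) Δ) '' YS α β (k + 1) := by
    ext Δ
    constructor
    · rintro ⟨⟨h0, hb, hcl⟩, hsd, hE⟩
      rw [closed_iff] at hcl
      rw [selfdual_iff α β hα hcop Δ hcl] at hsd
      rw [mingen_iff α β hα hβ Δ hcl hb] at hE
      obtain ⟨K, hK⟩ := hsd
      have hodd := symm_odd K Δ hK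
      obtain ⟨b, hb'⟩ := hβodd
      have hs : ∃ s : ℤ, K - 2 * s = -β := ⟨(K + β) / 2, by
        by_contra hne
        apply hodd
        exact ⟨K / 2, by omega⟩⟩
      obtain ⟨s, hs⟩ := hs
      have hY : sh s Δ ∈ YS α β (k + 1) := by
        refine ⟨sh_closed _ _ _ _ hcl, ?_, by rw [sh_gens]; exact hE⟩
        rw [← hs]
        exact sh_symm K s Δ hK
      refine ⟨sh s Δ, hY, ?_⟩
      have e1 := hμ1 _ hY
      have e2 := hμ2 _ hY
      have : μ (sh s Δ) = -s := by
        apply le_antisymm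
        · apply e2
          simpa [sh] using h0
        · have := hb _ e1
          omega
      simp only
      rw [this, sh_sh]
      simp [sh_zero]
    · rintro ⟨Δ, hY, rfl⟩
      have e1 := hμ1 _ hY
      have e2 := hμ2 _ hY
      obtain ⟨h1, h2, h3⟩ := hY
      have hcl := sh_closed _ _ (μ Δ) _ h1
      have hb : ∀ x ∈ sh (μ Δ) Δ, 0 ≤ x := by
        intro x hx
        have := e2 _ hx
        omega
      refine ⟨⟨by simpa [sh] using e1, hb, (closed_iff _ _ _).2 hcl⟩, ?_, ?_⟩
      · rw [selfdual_iff α β hα hcop _ hcl]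
        exact ⟨_, sh_symm _ _ _ h2⟩
      · rw [mingen_iff α β hα hβ _ hcl hb, sh_gens, h3]
  rw [himg, Set.InjOn.ncard_image]
  intro Δ hY Δ' hY' heq
  simp only at heq
  have h : Δ = sh (μ Δ' - μ Δ) Δ' := by
    have := congrArg (sh (-μ Δ)) heq
    rw [sh_sh, sh_sh] at this
    simp only [neg_add_cancel, sh_zero] at this
    rw [show μ Δ' - μ Δ = -μ Δ + μ Δ' by ring]
    exact this
  set t := μ Δ' - μ Δ with ht
  have hs := hY.2.1
  have hs2 := sh_symm _ t _ hY'.2.1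
  rw [← h] at hs2
  have hper : ∀ x, x ∈ Δ ↔ x + 2 * t ∈ Δ := by
    intro x
    have a1 := hs2 x
    have a2 := hs (x + 2 * t)
    rw [show (-(β : ℤ)) - (x + 2 * t) = -β - 2 * t - x by ring] at a2
    rw [a1, a2]
  have hμ := hμ1 _ hY
  have hl := hμ2 _ hY
  have l1 := hl _ ((hper _).1 hμ)
  have l2 := hl (μ Δ - 2 * t) ((hper _).2 (by simpa using hμ))
  have : t = 0 := by omega
  rw [this, sh_zero] at h
  exact h

/-! ### Height functions -/

def HS (α β : ℕ) (c : ℕ) : Set (ℤ → ℤ) :=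
  {h | (∀ j, h (j + 1) = h j ∨ h (j + 1) = h j + 1) ∧ (∀ j, h (j + (α + β)) = h j + α) ∧
    (∀ j, h (1 - j) = -h j) ∧
    ((Finset.Ioc (0 : ℤ) (α + β)).filter (fun j => h (j - 1) < h j ∧ h (j + 1) = h j)).card = c}

def DD (α β : ℕ) (h : ℤ → ℤ) : Set ℤ := {x | ∃ j k : ℤ, x = j * α + k * (α + β) ∧ -h j ≤ k}

lemma per_mul (h : ℤ → ℤ) (n a : ℤ) (hp : ∀ j, h (j + n) = h j + a) (t j : ℤ) :
    h (j + t * n) = h j + t * a := by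
  induction t using Int.induction_on with
  | zero => simp
  | succ i ih =>
    rw [show j + ((i : ℤ) + 1) * n = (j + i * n) + n by ring, hp, ih]
    ring
  | pred i ih =>
    have := hp (j + (-(i : ℤ) - 1) * n)
    rw [show j + (-(i : ℤ) - 1) * n + n = j + (-(i : ℤ)) * n by ring, ih] at this
    linarith

lemma rep_unique (α β : ℕ) (hα : 0 < α) (hcop : Nat.Coprime α β) (j k j' k' : ℤ)
    (h : j * α + k * (α + β) = j' * α + k' * (α + β)) :
    ∃ t : ℤ, j = j' + t * (α + β) ∧ k = k' - t * α := by
  have hc : IsCoprime (α : ℤ) (α + β : ℤ) := by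
    have : IsCoprime (α : ℤ) (β : ℤ) := Nat.isCoprime_iff_coprime.mpr hcop
    have := this.add_mul_left_right 1
    rwa [mul_one, add_comm] at this
  have hd : (α + β : ℤ) ∣ (j - j') * α := ⟨k' - k, by linear_combination h⟩
  obtain ⟨t, ht⟩ := hc.symm.dvd_of_dvd_mul_right hd
  refine ⟨t, by linear_combination ht, ?_⟩
  have hn : (α + β : ℤ) ≠ 0 := by positivity
  apply mul_right_cancel₀ hn
  linear_combination h - α * ht

lemma rep_exists (α β : ℕ) (hcop : Nat.Coprime α β) (x : ℤ) :
    ∃ j k : ℤ, x = j * α + k * (α + β) := by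
  have hc : IsCoprime (α : ℤ) (α + β : ℤ) := by
    have : IsCoprime (α : ℤ) (β : ℤ) := Nat.isCoprime_iff_coprime.mpr hcop
    have := this.add_mul_left_right 1
    rwa [mul_one, add_comm] at this
  obtain ⟨u, v, huv⟩ := hc
  exact ⟨x * u, x * v, by linear_combination (-x) * huv⟩

lemma mem_DD (α β : ℕ) (hα : 0 < α) (hcop : Nat.Coprime α β) (h : ℤ → ℤ)
    (hp : ∀ j, h (j + (α + β)) = h j + α) (j k : ℤ) :
    j * α + k * (α + β) ∈ DD α β h ↔ -h j ≤ k := by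
  constructor
  · rintro ⟨j', k', he, hk⟩
    obtain ⟨t, rfl, rfl⟩ := rep_unique α β hα hcop _ _ _ _ he
    rw [per_mul h _ _ hp]
    linarith
  · intro hk
    exact ⟨j, k, rfl, hk⟩

lemma DD_gens (α β : ℕ) (hα : 0 < α) (hcop : Nat.Coprime α β) (h : ℤ → ℤ)
    (h1 : ∀ j, h (j + 1) = h j ∨ h (j + 1) = h j + 1)
    (hp : ∀ j, h (j + (α + β)) = h j + α) :
    (gens α β (DD α β h)).ncard =
    ((Finset.Ioc (0 : ℤ) (α + β)).filter (fun j => h (j - 1) < h j ∧ h (j + 1) = h j)).card := by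
  have hn : (0 : ℤ) < α + β := by positivity
  have hg : ∀ j k : ℤ, j * α + k * (α + β) ∈ gens α β (DD α β h) ↔
      k = -h j ∧ h (j - 1) < h j ∧ h (j + 1) = h j := by
    intro j k
    simp only [gens, Set.mem_ofPred_eq]
    rw [show j * (α : ℤ) + k * (α + β) - α = (j - 1) * α + k * (α + β) by ring,
      show j * (α : ℤ) + k * (α + β) - β = (j + 1) * α + (k - 1) * (α + β) by ring,
      mem_DD α β hα hcop h hp, mem_DD α β hα hcop h hp, mem_DD α β hα hcop h hp]
    have := h1 j
    constructor
    · rintro ⟨a1, a2, a3⟩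
      refine ⟨?_, ?_, ?_⟩ <;> omega
    · rintro ⟨a1, a2, a3⟩
      refine ⟨?_, ?_, ?_⟩ <;> omega
  have himg : gens α β (DD α β h) = (fun j : ℤ => j * (α : ℤ) + (-h j) * (α + β)) ''
      (((Finset.Ioc (0 : ℤ) (α + β)).filter (fun j => h (j - 1) < h j ∧ h (j + 1) = h j) :
        Finset ℤ) : Set ℤ) := by
    ext x
    constructor
    · intro hx
      obtain ⟨j, k, rfl⟩ := rep_exists α β hcop x
      -- reduce j into (0, n]
      set t := (j - 1) / (α + β : ℤ) with ht
      have e1 := Int.emod_add_mul_ediv (j - 1) (α + β : ℤ)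
      have e2 := Int.emod_nonneg (j - 1) hn.ne'
      have e3 := Int.emod_lt_of_pos (j - 1) hn
      rw [← ht] at e1
      set j' := (j - 1) % (α + β : ℤ) + 1 with hj'
      have hj : j = j' + t * (α + β) := by rw [hj']; linear_combination -e1
      have hx' : j * (α : ℤ) + k * (α + β) = j' * α + (k + t * α) * (α + β) := by
        rw [hj]; ring
      rw [hx'] at hx ⊢
      obtain ⟨a1, a2⟩ := (hg _ _).1 hx
      refine ⟨j', ?_, ?_⟩
      · simp only [Finset.coe_filter, Finset.mem_Ioc, Set.mem_ofPred_eq]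
        refine ⟨⟨by omega, by omega⟩, a2⟩
      · simp only
        rw [a1]
    · rintro ⟨j, hj, rfl⟩
      simp only [Finset.coe_filter, Finset.mem_Ioc, Set.mem_ofPred_eq] at hj
      exact (hg _ _).2 ⟨rfl, hj.2⟩
  rw [himg, Set.InjOn.ncard_image, Set.ncard_coe_finset]
  intro j hj j' hj' he
  simp only [Finset.coe_filter, Finset.mem_Ioc, Set.mem_ofPred_eq] at hj hj' he
  obtain ⟨t, ht, -⟩ := rep_unique α β hα hcop _ _ _ _ he
  have : t = 0 := by
    by_contra hne
    rcases lt_or_gt_of_ne hne with hlt | hgt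
    · have : t * (α + β : ℤ) ≤ (-1) * (α + β : ℤ) := by
        apply mul_le_mul_of_nonneg_right _ hn.le
        omega
      omega
    · have : 1 * (α + β : ℤ) ≤ t * (α + β : ℤ) := by
        apply mul_le_mul_of_nonneg_right _ hn.le
        omega
      omega
  rw [ht, this]
  ring

lemma step2 (α β : ℕ) (hα : 0 < α) (hcop : Nat.Coprime α β) (c : ℕ) :
    (YS α β c).ncard = (HS α β c).ncard := by
  have hn : (0 : ℤ) < α + β := by positivity
  have himg : YS α β c = DD α β '' HS α β c := by
    ext Δ
    constructor
    · rintro ⟨hcl, hs, hc⟩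
      obtain ⟨B, hB1, hB2⟩ := symm_bdd α β hα hcop _ Δ hcl hs
      have hup : ∀ x ∈ Δ, ∀ k : ℕ, x + k * (α + β) ∈ Δ := by
        intro x hx k
        exact (closed_iff α β Δ).2 hcl x hx _ ⟨k, k, by ring⟩
      have hex : ∀ j : ℤ, ∃ H : ℤ, ∀ k : ℤ, j * α + k * (α + β) ∈ Δ ↔ -H ≤ k := by
        intro j
        obtain ⟨k0, hk0, hl⟩ := Int.exists_least_of_bdd
          (P := fun k => j * α + k * (α + β) ∈ Δ)
          ⟨-|B - j * α|, by
            intro k hk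
            have := hB1 _ hk
            by_contra hlt
            have h2 : k + 1 ≤ -|B - j * α| := by omega
            have h3 := neg_abs_le (B - j * α)
            have h4 : k * (α + β : ℤ) ≤ k * 1 := by
              apply mul_le_mul_of_nonpos_left
              · omega
              · have := abs_nonneg (B - j * α)
                omega
            omega⟩
          ⟨|-β - B - j * α| + 1, by
            apply hB2
            have h3 := le_abs_self (-β - B - j * α)
            have h4 : (|-β - B - j * α| + 1) * 1 ≤ (|-β - B - j * α| + 1) * (α + β : ℤ) := by
              apply mul_le_mul_of_nonneg_left
              · omega
              · positivity
            omega⟩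
        refine ⟨-k0, fun k => ?_⟩
        rw [neg_neg]
        refine ⟨hl k, fun hk => ?_⟩
        have := hup _ hk0 (k - k0).toNat
        rw [Int.toNat_of_nonneg (by omega)] at this
        convert this using 1
        ring
      choose h hh using hex
      have hΔ : DD α β h = Δ := by
        ext x
        constructor
        · rintro ⟨j, k, rfl, hk⟩
          exact (hh j k).2 hk
        · intro hx
          obtain ⟨j, k, rfl⟩ := rep_exists α β hcop x
          exact ⟨j, k, rfl, (hh j k).1 hx⟩
      have h1 : ∀ j, h (j + 1) = h j ∨ h (j + 1) = h j + 1 := by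
        intro j
        have a1 := (hcl _ ((hh j (-h j)).2 le_rfl)).1
        rw [show j * (α : ℤ) + -h j * (α + β) + α = (j + 1) * α + (-h j) * (α + β) by ring, hh] at a1
        have a2 := (hcl _ ((hh (j + 1) (-h (j + 1))).2 le_rfl)).2
        rw [show (j + 1) * (α : ℤ) + -h (j + 1) * (α + β) + β =
          j * α + (-h (j + 1) + 1) * (α + β) by ring, hh] at a2
        omega
      have h2 : ∀ j, h (j + (α + β)) = h j + α := by
        intro j
        have key : ∀ k, -h (j + (α + β)) ≤ k ↔ -h j ≤ k + α := by
          intro k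
          rw [← hh, ← hh]
          rw [show (j + (α + β : ℤ)) * α + k * (α + β) = j * α + (k + α) * (α + β) by ring]
        have k1 := (key (-h (j + (α + β)))).1 le_rfl
        have k2 := (key (-h j - α)).2 (by omega)
        omega
      have h3 : ∀ j, h (1 - j) = -h j := by
        intro j
        have key : ∀ k, -h j ≤ k ↔ ¬ (-h (1 - j) ≤ -k - 1) := by
          intro k
          rw [← hh, ← hh, hs]
          rw [show -(β : ℤ) - (j * α + k * (α + β)) = (1 - j) * α + (-k - 1) * (α + β) by ring]
        have k1 := (key (-h j)).1 le_rfl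
        have k2 := (key (h (1 - j))).2 (by omega)
        omega
      refine ⟨h, ⟨h1, h2, h3, ?_⟩, hΔ⟩
      rw [← DD_gens α β hα hcop h h1 h2, hΔ, hc]
    · rintro ⟨h, ⟨h1, h2, h3, h4⟩, rfl⟩
      refine ⟨?_, ?_, ?_⟩
      · intro x hx
        obtain ⟨j, k, rfl⟩ := rep_exists α β hcop x
        rw [mem_DD α β hα hcop h h2] at hx
        rw [show j * (α : ℤ) + k * (α + β) + α = (j + 1) * α + k * (α + β) by ring,
          show j * (α : ℤ) + k * (α + β) + β = (j - 1) * α + (k + 1) * (α + β) by ring,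
          mem_DD α β hα hcop h h2, mem_DD α β hα hcop h h2]
        have a1 := h1 j
        have a2 := h1 (j - 1)
        rw [sub_add_cancel] at a2
        omega
      · intro x
        obtain ⟨j, k, rfl⟩ := rep_exists α β hcop x
        rw [show -(β : ℤ) - (j * α + k * (α + β)) = (1 - j) * α + (-k - 1) * (α + β) by ring,
          mem_DD α β hα hcop h h2, mem_DD α β hα hcop h h2, h3]
        omega
      · rw [DD_gens α β hα hcop h h1 h2, h4]
  rw [himg, Set.InjOn.ncard_image]
  intro h hh h' hh' he
  funext j
  have key : ∀ k, -h j ≤ k ↔ -h' j ≤ k := by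
    intro k
    rw [← mem_DD α β hα hcop h hh.2.1, ← mem_DD α β hα hcop h' hh'.2.1, he]
  have k1 := (key (-h j)).1 le_rfl
  have k2 := (key (-h' j)).2 le_rfl
  omega

/-! ### Height functions versus words -/

lemma const_of_step (f : ℤ → ℤ) (h : ∀ j, f (j + 1) = f j) (j : ℤ) : f j = f 0 := by
  induction j using Int.induction_on with
  | zero => rfl
  | succ i ih => rw [h, ih]
  | pred i ih =>
    have := h (-(i : ℤ) - 1)
    rw [sub_add_cancel] at this
    rw [← this, ih]

lemma exists_integral (g : ℤ → ℤ) : ∃ h : ℤ → ℤ, h 0 = 0 ∧ ∀ j, h (j + 1) = h j + g j := by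
  refine ⟨fun j => (∑ i ∈ Finset.range j.toNat, g i) -
    ∑ i ∈ Finset.range (-j).toNat, g (-1 - i), by simp, ?_⟩
  intro j
  rcases le_or_gt 0 j with hj | hj
  · obtain ⟨k, rfl⟩ := Int.eq_ofNat_of_zero_le hj
    simp only
    rw [show ((k : ℤ) + 1).toNat = k + 1 by omega, show (k : ℤ).toNat = k by omega,
      show (-(k : ℤ)).toNat = 0 by omega, show (-((k : ℤ) + 1)).toNat = 0 by omega,
      Finset.sum_range_succ]
    simp
  · obtain ⟨k, rfl⟩ : ∃ k : ℕ, j = -1 - k := ⟨(-1 - j).toNat, by omega⟩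
    simp only
    rw [show (-1 - (k : ℤ) + 1).toNat = 0 by omega, show (-1 - (k : ℤ)).toNat = 0 by omega,
      show (-(-1 - (k : ℤ))).toNat = k + 1 by omega, show (-(-1 - (k : ℤ) + 1)).toNat = k by omega,
      Finset.sum_range_succ]
    simp

/-- the symmetric periodic extension -/
def ext2 (m : ℕ) (G : ℕ → Bool) (j : ℤ) : ℤ :=
  if G (min (j % (2 * m)).toNat (2 * m - (j % (2 * m)).toNat)) = true then 1 else 0

lemma sym_ext (m : ℕ) (hm : 0 < m) (g g' : ℤ → ℤ) (h1 : ∀ j, g (-j) = g j)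
    (h2 : ∀ j, g (j + 2 * m) = g j)
    (h1' : ∀ j, g' (-j) = g' j) (h2' : ∀ j, g' (j + 2 * m) = g' j)
    (he : ∀ i : ℕ, i ≤ m → g i = g' i) (j : ℤ) : g j = g' j := by
  have p := fun t j => per_mul g (2 * m) 0 (by simpa using h2) t j
  have p' := fun t j => per_mul g' (2 * m) 0 (by simpa using h2') t j
  have e1 := Int.emod_add_mul_ediv j (2 * m : ℤ)
  have e2 := Int.emod_nonneg j (b := (2 * m : ℤ)) (by omega)
  have e3 := Int.emod_lt_of_pos j (b := (2 * m : ℤ)) (by omega)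
  set r := j % (2 * m : ℤ) with hr
  have hj : j = r + (j / (2 * m)) * (2 * m) := by linear_combination -e1
  rw [hj, p, p']
  simp only [mul_zero, add_zero]
  rcases le_or_gt r m with h | h
  · have := he r.toNat (by omega)
    rwa [Int.toNat_of_nonneg e2] at this
  · have := he (2 * m - r).toNat (by omega)
    rw [Int.toNat_of_nonneg (by omega)] at this
    rw [← h1 r, ← h1' r, ← h2, ← h2']
    rwa [neg_add_eq_sub]

lemma ext2_per (m : ℕ) (G : ℕ → Bool) (j : ℤ) : ext2 m G (j + 2 * m) = ext2 m G j := by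
  simp [ext2]

lemma ext2_nat (m : ℕ) (_hm : 0 < m) (G : ℕ → Bool) (i : ℕ) (hi : i ≤ m) :
    ext2 m G i = if G i = true then 1 else 0 := by
  have : (i : ℤ) % (2 * m) = i := Int.emod_eq_of_lt (by omega) (by omega)
  unfold ext2
  rw [this]
  rw [show min (i : ℤ).toNat (2 * m - (i : ℤ).toNat) = i by omega]

lemma ext2_neg (m : ℕ) (hm : 0 < m) (G : ℕ → Bool) (j : ℤ) : ext2 m G (-j) = ext2 m G j := by
  have e1 := Int.emod_add_mul_ediv j (2 * m : ℤ)
  have e2 := Int.emod_nonneg j (b := (2 * m : ℤ)) (by omega)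
  have e3 := Int.emod_lt_of_pos j (b := (2 * m : ℤ)) (by omega)
  by_cases h0 : j % (2 * m : ℤ) = 0
  · have : (-j) % (2 * m : ℤ) = 0 := by
      rw [Int.emod_eq_zero_of_dvd]
      exact (Int.dvd_of_emod_eq_zero h0).neg_right
    unfold ext2
    rw [h0, this]
  · have : (-j) % (2 * m : ℤ) = 2 * m - j % (2 * m) := by
      rw [show -j = (2 * m - j % (2 * m)) + (-(j / (2 * m)) - 1) * (2 * m) by
        linear_combination e1, Int.add_mul_emod_self_right]
      exact Int.emod_eq_of_lt (by omega) (by omega)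
    unfold ext2
    rw [this]
    set r := j % (2 * m : ℤ)
    rw [show min (2 * (m : ℤ) - r).toNat (2 * m - (2 * (m : ℤ) - r).toNat) =
      min r.toNat (2 * m - r.toNat) by omega]

/-- basic facts on the height functions -/
lemma HS_facts (a b m : ℕ) (hm : m = a + b + 1) (h : ℤ → ℤ)
    (h1 : ∀ j, h (j + 1) = h j ∨ h (j + 1) = h j + 1)
    (h2 : ∀ j, h (j + 2 * m) = h j + (2 * a + 1)) (h3 : ∀ j, h (1 - j) = -h j) :
    h 0 = 0 ∧ h 1 = 0 ∧ h m = a ∧ h (m + 1) = a + 1 ∧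
    (∀ j, h (-j + 1) - h (-j) = h (j + 1) - h j) ∧
    (∀ j, h (j + 2 * m + 1) - h (j + 2 * m) = h (j + 1) - h j) := by
  have a1 := h1 0
  have a2 := h3 0
  have b1 := h1 m
  have b2 := h2 (1 - m)
  rw [show (1 - m + 2 * m : ℤ) = m + 1 by ring, h3] at b2
  simp only [zero_add, sub_zero] at a1 a2
  refine ⟨by omega, by omega, by omega, by omega, ?_, ?_⟩
  · intro j
    have c1 := h3 j
    have c2 := h3 (j + 1)
    rw [show (1 : ℤ) - (j + 1) = -j by ring] at c2
    rw [show -j + 1 = 1 - j by ring]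
    omega
  · intro j
    have c1 := h2 j
    have c2 := h2 (j + 1)
    rw [show j + 2 * m + 1 = j + 1 + 2 * m by ring]
    omega

/-- counting changes -/
lemma cnt_eq (m : ℕ) (hm : 0 < m) (h : ℤ → ℤ) (G : ℕ → Bool)
    (h1 : ∀ j, h (j + 1) = h j ∨ h (j + 1) = h j + 1)
    (hs : ∀ j, h (-j + 1) - h (-j) = h (j + 1) - h j)
    (hp : ∀ j, h (j + 2 * m + 1) - h (j + 2 * m) = h (j + 1) - h j)
    (hG : ∀ i : ℕ, i ≤ m → (G i = true ↔ h (i + 1) = h i + 1)) :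
    ((Finset.Ioc (0 : ℤ) (2 * m)).filter (fun j => h (j - 1) < h j ∧ h (j + 1) = h j)).card =
    ∑ i ∈ Finset.range m, if G i ≠ G (i + 1) then 1 else 0 := by
  rw [← Finset.card_filter]
  have hGf : ∀ i : ℕ, i ≤ m → (G i = false ↔ h (i + 1) = h i) := by
    intro i hi
    have := hG i hi
    have := h1 i
    cases hh : G i <;> simp_all
  -- left: j ∈ (0, m] or j ∈ (m, 2m]
  have hsplit : (Finset.Ioc (0 : ℤ) (2 * m)).filter (fun j => h (j - 1) < h j ∧ h (j + 1) = h j) =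
      ((Finset.range m).filter (fun i => G i = true ∧ G (i + 1) = false)).image
        (fun i : ℕ => (i : ℤ) + 1) ∪
      ((Finset.range m).filter (fun i => G i = false ∧ G (i + 1) = true)).image
        (fun i : ℕ => 2 * (m : ℤ) - i) := by
    ext j
    simp only [Finset.mem_filter, Finset.mem_Ioc, Finset.mem_union, Finset.mem_image,
      Finset.mem_range]
    have hrefl : ∀ x : ℤ, h (2 * m - x + 1) - h (2 * m - x) = h (x + 1) - h x := by
      intro x
      have e1 := hs x
      have e2 := hp (-x)
      rw [show -x + 2 * (m : ℤ) = 2 * m - x by ring] at e2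
      omega
    constructor
    · rintro ⟨⟨l1, l2⟩, l3, l4⟩
      rcases le_or_gt j m with hj | hj
      · left
        obtain ⟨i, rfl⟩ : ∃ i : ℕ, j = i + 1 := ⟨(j - 1).toNat, by omega⟩
        refine ⟨i, ⟨by omega, ?_, ?_⟩, rfl⟩
        · rw [hG i (by omega)]
          have := h1 i
          rw [add_sub_cancel_right] at l3
          omega
        · rw [hGf (i + 1) (by omega)]
          push_cast
          exact l4
      · right
        obtain ⟨i, rfl⟩ : ∃ i : ℕ, j = 2 * m - i := ⟨(2 * m - j).toNat, by omega⟩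
        refine ⟨i, ⟨by omega, ?_, ?_⟩, rfl⟩
        · rw [hGf i (by omega)]
          have := hrefl i
          omega
        · rw [hG (i + 1) (by omega)]
          have e := hrefl (i + 1)
          rw [show 2 * (m : ℤ) - (i + 1) + 1 = 2 * m - i by ring,
            show 2 * (m : ℤ) - (i + 1) = 2 * m - i - 1 by ring] at e
          have := h1 (i + 1)
          push_cast
          omega
    · rintro (⟨i, ⟨k1, k2, k3⟩, rfl⟩ | ⟨i, ⟨k1, k2, k3⟩, rfl⟩)
      · rw [hG i (by omega)] at k2
        rw [hGf (i + 1) (by omega)] at k3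
        push_cast at k3
        rw [add_sub_cancel_right]
        refine ⟨⟨by omega, by omega⟩, by omega, k3⟩
      · rw [hGf i (by omega)] at k2
        rw [hG (i + 1) (by omega)] at k3
        push_cast at k3
        have e0 := hrefl i
        have e := hrefl (i + 1)
        rw [show 2 * (m : ℤ) - (i + 1) + 1 = 2 * m - i by ring,
          show 2 * (m : ℤ) - (i + 1) = 2 * m - i - 1 by ring] at e
        refine ⟨⟨by omega, by omega⟩, by omega, by omega⟩
  rw [hsplit, Finset.card_union_of_disjoint, Finset.card_image_of_injective,
    Finset.card_image_of_injective, ← Finset.card_union_of_disjoint]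
  · congr 1
    ext i
    simp only [Finset.mem_union, Finset.mem_filter]
    cases G i <;> cases G (i + 1) <;> simp
  · rw [Finset.disjoint_left]
    intro i
    simp only [Finset.mem_filter]
    rintro ⟨_, k, _⟩ ⟨_, k', _⟩
    rw [k] at k'
    simp at k'
  · intro x y hxy
    simp only at hxy
    omega
  · intro x y hxy
    simp only at hxy
    omega
  · rw [Finset.disjoint_left]
    intro j
    simp only [Finset.mem_image, Finset.mem_filter, Finset.mem_range]
    rintro ⟨i, ⟨k, _⟩, rfl⟩ ⟨i', ⟨k', _⟩, e⟩
    omega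

lemma sum_eq (m : ℕ) (h : ℤ → ℤ) (G : ℕ → Bool)
    (h1 : ∀ j, h (j + 1) = h j ∨ h (j + 1) = h j + 1)
    (hG : ∀ i : ℕ, i < m → (G i = true ↔ h (i + 1) = h i + 1)) :
    ((∑ i ∈ Finset.range m, if G i = true then 1 else 0 : ℕ) : ℤ) = h m - h 0 := by
  induction m with
  | zero => simp
  | succ m ih =>
    rw [Finset.sum_range_succ]
    push_cast
    have := ih (fun i hi => hG i (by omega))
    push_cast at this
    rw [this]
    have e := hG m (by omega)
    have := h1 m
    split_ifs with hh
    · rw [e.1 hh]; ring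
    · rcases this with h | h
      · rw [h]; ring
      · exact absurd (e.2 h) hh

open Classical in
noncomputable def Phi (m : ℕ) (h : ℤ → ℤ) (i : ℕ) : Bool :=
  if i < m then decide (h (i + 1) = h i + 1) else true

lemma step3 (a b c : ℕ) :
    (HS (2 * a + 1) (2 * b + 1) c).ncard = (WT false (a + b + 1) a c).ncard := by
  obtain ⟨m, hm⟩ : ∃ m, m = a + b + 1 := ⟨_, rfl⟩
  have hm0 : 0 < m := by omega
  have hn : (((2 * a + 1 : ℕ) : ℤ) + ((2 * b + 1 : ℕ) : ℤ)) = 2 * m := by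
    rw [hm]; push_cast; ring
  have hHS : HS (2 * a + 1) (2 * b + 1) c = {h : ℤ → ℤ | (∀ j, h (j + 1) = h j ∨ h (j + 1) = h j + 1) ∧
      (∀ j, h (j + 2 * m) = h j + (2 * a + 1)) ∧ (∀ j, h (1 - j) = -h j) ∧
      ((Finset.Ioc (0 : ℤ) (2 * m)).filter
        (fun j => h (j - 1) < h j ∧ h (j + 1) = h j)).card = c} := by
    unfold HS
    rw [hn]
    push_cast
    rfl
  rw [hHS, ← hm]
  have himg : WT false m a c = Phi m '' {h : ℤ → ℤ | (∀ j, h (j + 1) = h j ∨ h (j + 1) = h j + 1) ∧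
      (∀ j, h (j + 2 * m) = h j + (2 * a + 1)) ∧ (∀ j, h (1 - j) = -h j) ∧
      ((Finset.Ioc (0 : ℤ) (2 * m)).filter
        (fun j => h (j - 1) < h j ∧ h (j + 1) = h j)).card = c} := by
    ext G
    constructor
    · rintro ⟨g0, g1, g2, g3⟩
      obtain ⟨h, hh0, hh⟩ := exists_integral (ext2 m G)
      have h1 : ∀ j, h (j + 1) = h j ∨ h (j + 1) = h j + 1 := by
        intro j
        rw [hh]
        unfold ext2
        split_ifs <;> simp
      have hG : ∀ i : ℕ, i ≤ m → (G i = true ↔ h (i + 1) = h i + 1) := by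
        intro i hi
        rw [hh, ext2_nat m hm0 G i hi]
        split_ifs with hg <;> simp [hg]
      have h3 : ∀ j, h (1 - j) = -h j := by
        intro j
        have := const_of_step (fun j => h (1 - j) + h j) (by
          intro j
          try simp only
          have e := hh (-j)
          rw [ext2_neg m hm0] at e
          rw [hh j, show 1 - (j + 1) = -j by ring, show 1 - j = -j + 1 by ring, e]
          ring) j
        simp only [sub_zero] at this
        have e := hh 0
        have e2 := ext2_nat m hm0 G 0 (by omega)
        simp [g0] at e2
        rw [e2, zero_add] at e
        omega
      have hsum := sum_eq m h G h1 (fun i hi => hG i hi.le)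
      rw [g2, hh0] at hsum
      have h2 : ∀ j, h (j + 2 * m) = h j + (2 * a + 1) := by
        have key := const_of_step (fun j => h (j + 2 * m) - h j) (by
          intro j
          try simp only
          rw [show j + 1 + 2 * (m : ℤ) = j + 2 * m + 1 by ring, hh, hh, ext2_per]
          ring)
        have k1 := key (1 - m)
        try simp only at k1 key
        rw [show (1 - m + 2 * m : ℤ) = m + 1 by ring, h3,
          (hG m le_rfl).1 (g1 m le_rfl)] at k1
        intro j
        have := key j
        omega
      obtain ⟨-, -, -, -, f1, f2⟩ := HS_facts a b m hm h h1 h2 h3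
      refine ⟨h, ⟨h1, h2, h3, ?_⟩, ?_⟩
      · rw [cnt_eq m hm0 h G h1 f1 f2 hG, g3]
      · funext i
        unfold Phi
        split_ifs with hi
        · have := hG i hi.le
          by_cases hgi : h (i + 1) = h i + 1
          · rw [decide_eq_true hgi, this.2 hgi]
          · rw [decide_eq_false hgi]
            cases hg : G i
            · rfl
            · exact absurd (this.1 hg) hgi
        · rw [g1 i (by omega)]
    · rintro ⟨h, ⟨h1, h2, h3, h4⟩, rfl⟩
      obtain ⟨e0, e1, em, em1, f1, f2⟩ := HS_facts a b m hm h h1 h2 h3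
      have hG : ∀ i : ℕ, i ≤ m → (Phi m h i = true ↔ h (i + 1) = h i + 1) := by
        intro i hi
        unfold Phi
        split_ifs with hi'
        · simp
        · obtain rfl : i = m := by omega
          simp [em, em1]
      refine ⟨?_, ?_, ?_, ?_⟩
      · have := hG 0 (by omega)
        simp [e0, e1] at this
        exact this
      · intro i hi
        unfold Phi
        rw [if_neg (by omega)]
      · have := sum_eq m h _ h1 (fun i hi => hG i hi.le)
        rw [em, e0, sub_zero] at this
        exact_mod_cast this
      · rw [← cnt_eq m hm0 h _ h1 f1 f2 hG, h4]
  rw [himg, Set.InjOn.ncard_image]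
  rintro h ⟨h1, h2, h3, h4⟩ h' ⟨h1', h2', h3', h4'⟩ he
  obtain ⟨e0, e1, em, em1, f1, f2⟩ := HS_facts a b m hm h h1 h2 h3
  obtain ⟨e0', e1', em', em1', f1', f2'⟩ := HS_facts a b m hm h' h1' h2' h3'
  have key := sym_ext m hm0 (fun j => h (j + 1) - h j) (fun j => h' (j + 1) - h' j)
    f1 f2 f1' f2' (by
      intro i hi
      try simp only
      by_cases hi' : i < m
      · have := congrFun he i
        unfold Phi at this
        rw [if_pos hi', if_pos hi', decide_eq_decide] at this
        have a1 := h1 i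
        have a2 := h1' i
        omega
      · obtain rfl : i = m := by omega
        rw [em, em1, em', em1'])
  funext j
  have := const_of_step (fun j => h j - h' j) (by
    intro j
    have := key j
    try simp only at this ⊢
    omega) j
  try simp only at this
  omega
/-- If `α` and `β` are both odd, for every `ℓ ≤ (α-1)/2` there are exactly
`C((α-1)/2, ℓ) · C((β-1)/2, ℓ)` selfdual semimodules with `2ℓ + 1` minimal
generators. -/
theorem count_selfdual_odd_odd_by_generators (α β : ℕ)
    (hα : 3 ≤ α) (hαβ : α < β) (hcop : Nat.Coprime α β)
    (hαodd : Odd α) (hβodd : Odd β)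
    (ℓ : ℕ) (hℓ : ℓ ≤ (α - 1) / 2) :
    {Δ : Set ℤ | IsNormalizedSemimodule α β Δ ∧ IsSelfdual α β Δ ∧
        ∃ E : Finset ℤ, IsMinGenSet α β Δ E ∧ E.card = 2 * ℓ + 1}.ncard =
      Nat.choose ((α - 1) / 2) ℓ * Nat.choose ((β - 1) / 2) ℓ := by
  obtain ⟨a, rfl⟩ := hαodd
  obtain ⟨b, rfl⟩ := hβodd
  rw [step1 (2 * a + 1) (2 * b + 1) (by omega) (by omega) hcop ⟨b, rfl⟩ (2 * ℓ),
    step2 _ _ (by omega) hcop, step3,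
    (WT_card (a + b + 1)).1 a b ℓ (by omega),
    show (2 * a + 1 - 1) / 2 = a by omega, show (2 * b + 1 - 1) / 2 = b by omega]
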